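/- Let r ≥ 1 be an integer and let s_r(P_n) denote the number of r-matchings in the path P_n on n vertices, with s_r(P_0) = 1. Then for every n ≥ 2r, s_r(P_{2n}) = s_r(P_{n-r}) · s_r(P_n) + Σ_{i=0}^{r} s_r(P_{n-2r+i}) · s_r(P_{n-i}). -/

import Mathlib

open SimpleGraph Filter

/-- The distance between two edges `e, f` of a graph `G`: the minimum distance between
a vertex incident to `e` and a vertex incident to `f`. -/
noncomputable def edgeDist {V : Type*} (G : SimpleGraph V) (e f : Sym2 V) : ℕ :=
  sInf {d : ℕ | ∃ u ∈ e, ∃ w ∈ f, G.dist u w = d}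

/-- `M` is an `r`-matching in `G`: a set of edges of `G` any two distinct members of which
are at distance at least `r`. -/
def IsRMatching {V : Type*} (G : SimpleGraph V) (r : ℕ) (M : Finset (Sym2 V)) : Prop :=
  (∀ e ∈ M, e ∈ G.edgeSet) ∧ ∀ e ∈ M, ∀ f ∈ M, e ≠ f → r ≤ edgeDist G e f

/-- The number of `r`-matchings in `G`. -/
noncomputable def numRMatchings {V : Type*} (G : SimpleGraph V) (r : ℕ) : ℕ :=
  Nat.card {M : Finset (Sym2 V) // IsRMatching G r M}

/-- `s_r(P_n)`: the number of `r`-matchings in the path on `n` vertices. -/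
noncomputable def pathMatchings (r n : ℕ) : ℕ :=
  numRMatchings (SimpleGraph.pathGraph n) r

/-- gap sets -/
def gapSets (r k : ℕ) : Finset (Finset ℕ) :=
  (Finset.range k).powerset.filter (fun A => ∀ i ∈ A, ∀ j ∈ A, i < j → i + r < j)

lemma mem_gapSets (r k : ℕ) (A : Finset ℕ) : A ∈ gapSets r k ↔
    (∀ i ∈ A, i < k) ∧ ∀ i ∈ A, ∀ j ∈ A, i < j → i + r < j := by
  simp [gapSets, Finset.subset_iff]

lemma gapSets_succ (r k : ℕ) :
    (gapSets r (k+1)).card = (gapSets r k).card + (gapSets r (k - r)).card := by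
  have h : gapSets r (k+1) = gapSets r k ∪ (gapSets r (k-r)).image (insert k) := by
    ext A
    rw [Finset.mem_union, Finset.mem_image, mem_gapSets, mem_gapSets]
    constructor
    · rintro ⟨h1, h2⟩
      by_cases hk : k ∈ A
      · right
        refine ⟨A.erase k, ?_, Finset.insert_erase hk⟩
        rw [mem_gapSets]
        simp only [Finset.mem_erase]
        refine ⟨fun i hi => ?_, fun i hi j hj => h2 i hi.2 j hj.2⟩
        have := h1 i hi.2
        have := h2 i hi.2 k hk (by omega)
        omega
      · left
        refine ⟨fun i hi => ?_, h2⟩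
        have := h1 i hi
        have : i ≠ k := fun h => hk (h ▸ hi)
        omega
    · rintro (⟨h1, h2⟩ | ⟨B, hB, rfl⟩)
      · exact ⟨fun i hi => by have := h1 i hi; omega, h2⟩
      · rw [mem_gapSets] at hB
        obtain ⟨h1, h2⟩ := hB
        simp only [Finset.mem_insert]
        refine ⟨?_, ?_⟩
        · rintro i (rfl | hi)
          · omega
          · have := h1 i hi; omega
        · rintro i (rfl | hi) j (rfl | hj) hij
          · omega
          · have := h1 j hj; omega
          · have := h1 i hi; omega
          · exact h2 i hi j hj hij
  rw [h, Finset.card_union_of_disjoint, Finset.card_image_of_injOn]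
  · intro A hA B hB hAB
    simp only [Finset.mem_coe, mem_gapSets] at hA hB
    have ha : k ∉ A := fun h => by have := hA.1 k h; omega
    have hb : k ∉ B := fun h => by have := hB.1 k h; omega
    have : (insert k A).erase k = (insert k B).erase k := by
      rw [hAB]
    rwa [Finset.erase_insert ha, Finset.erase_insert hb] at this
  · rw [Finset.disjoint_left]
    intro A hA hA'
    rw [Finset.mem_image] at hA'
    obtain ⟨B, -, rfl⟩ := hA'
    rw [mem_gapSets] at hA
    have := hA.1 k (Finset.mem_insert_self _ _)
    omega

lemma gapSets_zero (r : ℕ) : (gapSets r 0).card = 1 := by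
  rw [Finset.card_eq_one]
  refine ⟨∅, ?_⟩
  ext A
  rw [mem_gapSets, Finset.mem_singleton]
  constructor
  · rintro ⟨h, -⟩
    exact Finset.eq_empty_of_forall_notMem fun i hi => by have := h i hi; omega
  · rintro rfl
    simp

lemma walk_len (n : ℕ) (u v : Fin n) (w : (pathGraph n).Walk u v) :
    v.val ≤ u.val + w.length ∧ u.val ≤ v.val + w.length := by
  induction w with
  | nil => simp
  | cons h p ih =>
    rw [pathGraph_adj] at h
    simp only [Walk.length_cons]
    omega

lemma walk_ex (n : ℕ) (d : ℕ) : ∀ u v : Fin n, v.val = u.val + d →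
    ∃ w : (pathGraph n).Walk u v, w.length = d := by
  induction d with
  | zero =>
    intro u v h
    obtain rfl : v = u := Fin.ext (by simpa using h)
    exact ⟨Walk.nil, rfl⟩
  | succ d ih =>
    intro u v h
    have hv := v.isLt
    obtain ⟨w, hw⟩ := ih ⟨u.val + 1, by omega⟩ v (by simp only; omega)
    have ha : (pathGraph n).Adj u ⟨u.val + 1, by omega⟩ := by
      rw [pathGraph_adj]; simp
    exact ⟨Walk.cons ha w, by simp [hw]⟩

lemma dist_path (n : ℕ) (u v : Fin n) (h : u ≤ v) : (pathGraph n).dist u v = v.val - u.val := by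
  rw [Fin.le_def] at h
  obtain ⟨w, hw⟩ := walk_ex n (v.val - u.val) u v (by omega)
  apply le_antisymm
  · rw [← hw]; exact dist_le w
  · obtain ⟨p, hp⟩ := w.reachable.exists_walk_length_eq_dist
    have := walk_len n u v p
    omega

/-- i-th edge -/
def pe (k : ℕ) (i : ℕ) : Sym2 (Fin (k+1)) := s(Fin.ofNat (k+1) i, Fin.ofNat (k+1) (i+1))

lemma ofNat_val (k i : ℕ) (h : i ≤ k) : (Fin.ofNat (k+1) i).val = i := by
  simp [Fin.ofNat, Nat.mod_eq_of_lt (Nat.lt_succ_of_le h)]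

lemma pe_inj (k i j : ℕ) (hi : i < k) (hj : j < k) (h : pe k i = pe k j) : i = j := by
  unfold pe at h
  rw [Sym2.eq_iff] at h
  simp only [Fin.ext_iff] at h
  rw [ofNat_val k i (by omega), ofNat_val k j (by omega), ofNat_val k (i+1) (by omega),
    ofNat_val k (j+1) (by omega)] at h
  omega

lemma edgeDist_pe (k i j : ℕ) (hj : j < k) (hij : i < j) :
    edgeDist (pathGraph (k+1)) (pe k i) (pe k j) = j - (i + 1) := by
  have e1 := ofNat_val k i (by omega)
  have e2 := ofNat_val k j (by omega)
  have e3 := ofNat_val k (i+1) (by omega)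
  have e4 := ofNat_val k (j+1) (by omega)
  apply le_antisymm
  · apply Nat.sInf_le
    refine ⟨Fin.ofNat (k+1) (i+1), by simp [pe], Fin.ofNat (k+1) j, by simp [pe], ?_⟩
    rw [dist_path _ _ _ (by rw [Fin.le_def]; omega), e2, e3]
  · apply le_csInf
    · exact ⟨_, _, Sym2.mem_mk_left _ _, _, Sym2.mem_mk_left _ _, rfl⟩
    · rintro d ⟨u, hu, w, hw, rfl⟩
      have hu' : u.val = i ∨ u.val = i + 1 := by
        simp only [pe, Sym2.mem_iff, Fin.ext_iff] at hu; omega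
      have hw' : w.val = j ∨ w.val = j + 1 := by
        simp only [pe, Sym2.mem_iff, Fin.ext_iff] at hw; omega
      rw [dist_path _ _ _ (by rw [Fin.le_def]; omega)]
      omega

lemma edgeDist_comm' {V : Type*} (G : SimpleGraph V) (e f : Sym2 V) :
    edgeDist G e f = edgeDist G f e := by
  unfold edgeDist
  congr 1
  ext d
  constructor
  · rintro ⟨u, hu, w, hw, h⟩
    exact ⟨w, hw, u, hu, by rw [dist_comm]; exact h⟩
  · rintro ⟨u, hu, w, hw, h⟩
    exact ⟨w, hw, u, hu, by rw [dist_comm]; exact h⟩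

lemma mem_edge (k : ℕ) (e : Sym2 (Fin (k+1))) :
    e ∈ (pathGraph (k+1)).edgeSet ↔ ∃ i < k, pe k i = e := by
  constructor
  · induction e using Sym2.ind with
    | _ u v =>
      intro h
      rw [mem_edgeSet, pathGraph_adj] at h
      have hu := u.isLt
      have hv := v.isLt
      rcases h with h | h
      · refine ⟨u.val, by omega, ?_⟩
        unfold pe
        rw [Sym2.eq_iff]
        left
        simp only [Fin.ext_iff]
        rw [ofNat_val _ _ (by omega), ofNat_val _ _ (by omega)]
        omega
      · refine ⟨v.val, by omega, ?_⟩
        unfold pe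
        rw [Sym2.eq_iff]
        right
        simp only [Fin.ext_iff]
        rw [ofNat_val _ _ (by omega), ofNat_val _ _ (by omega)]
        omega
  · rintro ⟨i, hi, rfl⟩
    unfold pe
    rw [mem_edgeSet, pathGraph_adj, ofNat_val _ _ (by omega), ofNat_val _ _ (by omega)]
    left; rfl

lemma isR_iff (r k : ℕ) (hr : 1 ≤ r) (A : Finset ℕ) (hA : ∀ i ∈ A, i < k) :
    IsRMatching (pathGraph (k+1)) r (A.image (pe k)) ↔
      ∀ i ∈ A, ∀ j ∈ A, i < j → i + r < j := by
  constructor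
  · rintro ⟨-, h⟩ i hi j hj hij
    have := h _ (Finset.mem_image_of_mem _ hi) _ (Finset.mem_image_of_mem _ hj)
      (fun h => by have := pe_inj k i j (hA i hi) (hA j hj) h; omega)
    rw [edgeDist_pe k i j (hA j hj) hij] at this
    omega
  · intro h
    refine ⟨?_, ?_⟩
    · intro e he
      rw [Finset.mem_image] at he
      obtain ⟨i, hi, rfl⟩ := he
      exact (mem_edge _ _).2 ⟨i, hA i hi, rfl⟩
    · intro e he f hf hef
      rw [Finset.mem_image] at he hf
      obtain ⟨i, hi, rfl⟩ := he
      obtain ⟨j, hj, rfl⟩ := hf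
      have hne : i ≠ j := fun h => hef (by rw [h])
      rcases lt_or_gt_of_ne hne with hij | hij
      · rw [edgeDist_pe k i j (hA j hj) hij]
        have := h i hi j hj hij
        omega
      · rw [edgeDist_comm', edgeDist_pe k j i (hA i hi) hij]
        have := h j hj i hi hij
        omega

lemma pm_succ (r k : ℕ) (hr : 1 ≤ r) : pathMatchings r (k+1) = (gapSets r k).card := by
  classical
  unfold pathMatchings numRMatchings
  rw [Nat.card_eq_fintype_card, Fintype.card_subtype]
  symm
  apply Finset.card_bij (fun A _ => A.image (pe k))
  · intro A hA
    rw [mem_gapSets] at hA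
    rw [Finset.mem_filter]
    exact ⟨Finset.mem_univ _, (isR_iff r k hr A hA.1).2 hA.2⟩
  · intro A hA B hB h
    rw [mem_gapSets] at hA hB
    have key : ∀ A B : Finset ℕ, (∀ i ∈ A, i < k) → (∀ i ∈ B, i < k) →
        A.image (pe k) = B.image (pe k) → A ⊆ B := by
      intro A B hA hB h i hi
      have := Finset.mem_image_of_mem (pe k) hi
      rw [h, Finset.mem_image] at this
      obtain ⟨j, hj, hji⟩ := this
      rwa [← pe_inj k j i (hB j hj) (hA i hi) hji]
    exact Finset.Subset.antisymm (key A B hA.1 hB.1 h) (key B A hB.1 hA.1 h.symm)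
  · intro M hM
    rw [Finset.mem_filter] at hM
    have hlt : ∀ i ∈ (Finset.range k).filter (fun i => pe k i ∈ M), i < k := by
      intro i hi
      rw [Finset.mem_filter, Finset.mem_range] at hi
      exact hi.1
    have him : ((Finset.range k).filter (fun i => pe k i ∈ M)).image (pe k) = M := by
      ext e
      simp only [Finset.mem_image, Finset.mem_filter, Finset.mem_range]
      constructor
      · rintro ⟨i, ⟨_, h⟩, rfl⟩; exact h
      · intro he
        obtain ⟨i, hi, rfl⟩ := (mem_edge _ _).1 (hM.2.1 e he)
        exact ⟨i, ⟨hi, he⟩, rfl⟩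
    refine ⟨_, (mem_gapSets _ _ _).2 ⟨hlt, ?_⟩, him⟩
    rw [← isR_iff r k hr _ hlt, him]
    exact hM.2

lemma pm_zero (r : ℕ) : pathMatchings r 0 = 1 := by
  unfold pathMatchings numRMatchings
  rw [Nat.card_eq_one_iff_unique]
  refine ⟨⟨fun a b => ?_⟩, ⟨⟨∅, by simp [IsRMatching]⟩⟩⟩
  apply Subtype.ext
  exact Subsingleton.elim _ _

lemma pm_one (r : ℕ) (hr : 1 ≤ r) : pathMatchings r 1 = 1 := by
  rw [pm_succ r 0 hr, gapSets_zero]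

lemma pm_rec (r : ℕ) (hr : 1 ≤ r) (n : ℕ) :
    pathMatchings r (n+2) = pathMatchings r (n+1) + pathMatchings r (n+1-r) := by
  rw [pm_succ r (n+1) hr, pm_succ r n hr, gapSets_succ]
  congr 1
  by_cases h : r ≤ n
  · rw [show n + 1 - r = (n - r) + 1 by omega, pm_succ r _ hr]
  · rw [show n + 1 - r = 0 by omega, show n - r = 0 by omega, pm_zero, gapSets_zero]

lemma pm_rec' (r : ℕ) (hr : 1 ≤ r) (x : ℕ) :
    pathMatchings r (x+r+1) = pathMatchings r (x+r) + pathMatchings r x := by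
  obtain ⟨q, rfl⟩ : ∃ q, r = q + 1 := ⟨r - 1, by omega⟩
  have := pm_rec (q+1) hr (x+q)
  rw [show x + q + 1 - (q+1) = x by omega] at this
  exact this

lemma pm_small (r : ℕ) (hr : 1 ≤ r) (k : ℕ) (hk : k + 1 ≤ r) : pathMatchings r (k+1) = k + 1 := by
  induction k with
  | zero => exact pm_one r hr
  | succ k ih =>
    rw [pm_rec r hr, ih (by omega), show k + 1 - r = 0 by omega, pm_zero]

lemma pm_tel (r : ℕ) (hr : 1 ≤ r) (p k : ℕ) :
    pathMatchings r (p+r+k) = pathMatchings r (p+r) + ∑ l ∈ Finset.range k, pathMatchings r (p+l) := by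
  induction k with
  | zero => simp
  | succ k ih =>
    rw [Finset.sum_range_succ, ← add_assoc (pathMatchings r (p+r)), ← ih]
    have := pm_rec' r hr (p+k)
    rw [show p + r + (k+1) = p + k + r + 1 by ring, this, show p + k + r = p + r + k by ring]

lemma pm_tel2 (r : ℕ) (hr : 1 ≤ r) (p k : ℕ) :
    pathMatchings r (p+2*r+k) = (k+1) * pathMatchings r (p+r)
      + ∑ l ∈ Finset.range r, pathMatchings r (p+l)
      + ∑ l ∈ Finset.range k, pathMatchings r (p+l) * (k-1-l) := by
  induction k with
  | zero =>
    have := pm_tel r hr p r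
    rw [show p + 2*r + 0 = p + r + r by ring, this]
    simp
  | succ k ih =>
    have h1 := pm_rec' r hr (p+r+k)
    have h2 := pm_tel r hr p k
    have h3 : ∑ l ∈ Finset.range (k+1), pathMatchings r (p+l) * (k+1-1-l)
        = ∑ l ∈ Finset.range k, pathMatchings r (p+l) * (k-1-l)
          + ∑ l ∈ Finset.range k, pathMatchings r (p+l) := by
      rw [Finset.sum_range_succ, ← Finset.sum_add_distrib]
      simp only [Nat.add_sub_cancel, Nat.sub_self, mul_zero, add_zero]
      apply Finset.sum_congr rfl
      intro l hl
      rw [Finset.mem_range] at hl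
      rw [show k - l = (k - 1 - l) + 1 by omega]
      ring
    rw [h3, show p + 2*r + (k+1) = p + r + k + r + 1 by ring, h1,
      show p + r + k + r = p + 2*r + k by ring, ih, h2]
    ring

lemma pm_base (r : ℕ) (hr : 1 ≤ r) (p : ℕ) :
    pathMatchings r (p+2*r+r) = pathMatchings r (p+r) * pathMatchings r r +
      ∑ i ∈ Finset.range (r+1), pathMatchings r (p+i) * pathMatchings r (r-i) := by
  have hrr : pathMatchings r r = r := by
    obtain ⟨q, rfl⟩ : ∃ q, r = q + 1 := ⟨r - 1, by omega⟩
    exact pm_small _ hr q le_rfl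
  rw [pm_tel2 r hr, Finset.sum_range_succ, Nat.sub_self, pm_zero, hrr]
  have : ∑ i ∈ Finset.range r, pathMatchings r (p+i) * pathMatchings r (r-i)
      = ∑ l ∈ Finset.range r, pathMatchings r (p+l)
      + ∑ l ∈ Finset.range r, pathMatchings r (p+l) * (r-1-l) := by
    rw [← Finset.sum_add_distrib]
    apply Finset.sum_congr rfl
    intro l hl
    rw [Finset.mem_range] at hl
    rw [show r - l = (r - 1 - l) + 1 by omega, pm_small r hr _ (by omega)]
    ring
  rw [this]
  ring

lemma pm_gen (r : ℕ) (hr : 1 ≤ r) (d : ℕ) : ∀ p : ℕ,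
    pathMatchings r (p+2*r+(r+d)) = pathMatchings r (p+r) * pathMatchings r (r+d) +
      ∑ i ∈ Finset.range (r+1), pathMatchings r (p+i) * pathMatchings r (r+d-i) := by
  induction d with
  | zero => intro p; exact pm_base r hr p
  | succ d ih =>
    intro p
    have h := ih (p+1)
    rw [show p + 2*r + (r+(d+1)) = p + 1 + 2*r + (r+d) by ring, h,
      Finset.sum_range_succ, Finset.sum_range_succ']
    have e : ∀ i ∈ Finset.range r, pathMatchings r (p+1+i) * pathMatchings r (r+d-i)
      = pathMatchings r (p+(i+1)) * pathMatchings r (r+(d+1)-(i+1)) := by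
      intro i _
      rw [show p + 1 + i = p + (i+1) by ring, show r+(d+1)-(i+1) = r+d-i by omega]
    rw [Finset.sum_congr rfl e]
    have h1 := pm_rec' r hr d
    have h2 := pm_rec' r hr p
    rw [show r + d - r = d by omega, show r + (d+1) - 0 = d + r + 1 by omega,
      show r + (d+1) = d + r + 1 by ring, show p + 1 + r = p + r + 1 by ring,
      show r + d = d + r by ring, h1, h2, add_zero]
    ring

/-- For every `r ≥ 1` and every `n ≥ 2r`,
`s_r(P_{2n}) = s_r(P_{n-r}) · s_r(P_n) + Σ_{i=0}^{r} s_r(P_{n-2r+i}) · s_r(P_{n-i})`. -/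
theorem stmt8 (r : ℕ) (hr : 1 ≤ r) (n : ℕ) (hn : 2 * r ≤ n) :
    pathMatchings r (2 * n) =
      pathMatchings r (n - r) * pathMatchings r n +
        ∑ i ∈ Finset.range (r + 1),
          pathMatchings r (n - 2 * r + i) * pathMatchings r (n - i) := by
  have h := pm_gen r hr (n - r) (n - 2*r)
  rw [show n - 2*r + 2*r + (r + (n-r)) = 2 * n by omega, show n - 2*r + r = n - r by omega,
    show r + (n - r) = n by omega] at h
  exact h
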